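/- Let m ≥ 18 and n ≥ m² − m + 1 be integers, let U be a connected graph with n vertices and exactly n edges (a unicyclic graph), and let G be a graph on 2n − 1 vertices that does not contain the fan F_m as a subgraph and whose complement does not contain U as a subgraph. Then the maximum degree of G satisfies Δ(G) ≥ n. -/

import Mathlib

/-- `Contains G H` means `G` contains a subgraph isomorphic to `H`, i.e. there is an
injective map on vertices preserving adjacency. -/
def Contains {α β : Type*} (G : SimpleGraph α) (H : SimpleGraph β) : Prop :=
  ∃ f : β → α, Function.Injective f ∧ ∀ ⦃u v⦄, H.Adj u v → G.Adj (f u) (f v)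

/-- The fan `F_m = K_1 + mK_2`: a center vertex joined to `m` disjoint edges,
so `m` triangles sharing exactly one common vertex; it has `2m + 1` vertices. -/
def fan (m : ℕ) : SimpleGraph (Unit ⊕ Fin m × Bool) :=
  SimpleGraph.fromRel (fun x y =>
    (∃ u, x = Sum.inl u) ∨ ∃ i : Fin m, x = Sum.inr (i, true) ∧ y = Sum.inr (i, false))

section FanHelpers

open Finset

/-- A list forming a cycle in `H`. -/
def IsCyc {W : Type*} (H : SimpleGraph W) (l : List W) : Prop :=
  l.Nodup ∧ l.IsChain H.Adj ∧ ∀ x ∈ l.getLast?, ∀ y ∈ l.head?, H.Adj x y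

theorem IsCyc.swap {W : Type*} {H : SimpleGraph W} {p q : List W}
    (h : IsCyc H (p ++ q)) : IsCyc H (q ++ p) := by
  rcases p.eq_nil_or_concat with rfl | ⟨p', a, rfl⟩
  · simpa using h
  rcases q with _ | ⟨b, q⟩
  · simpa using h
  obtain ⟨h1, h2, h3⟩ := h
  refine ⟨?_, ?_, ?_⟩
  · exact List.nodup_append_comm.1 h1
  · rw [List.isChain_append] at h2 ⊢
    refine ⟨h2.2.1, h2.1, ?_⟩
    intro x hx y hy
    apply h3
    · rw [List.getLast?_append]; simp_all
    · rw [List.head?_append]; simp_all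
  · rw [List.isChain_append] at h2
    intro x hx y hy
    apply h2.2.2
    · rw [List.getLast?_append] at hx; simp_all
    · simpa using hy

theorem IsCyc.rotate {W : Type*} {H : SimpleGraph W} {l : List W}
    (h : IsCyc H l) (k : ℕ) (hk : k ≤ l.length) : IsCyc H (l.rotate k) := by
  rw [List.rotate_eq_drop_append_take hk]
  apply IsCyc.swap
  rwa [List.take_append_drop]

theorem IsCyc.of_path {W : Type*} {H : SimpleGraph W} {l : List W}
    (a1 : l.Nodup) (a2 : l.IsChain H.Adj) (v : W) (hv : v ∉ l) (h0 : 0 < l.length)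
    (h1 : H.Adj v (l[0])) (h2 : H.Adj v (l[l.length - 1])) :
    IsCyc H (v :: l) := by
  refine ⟨by simp [hv, a1], ?_, ?_⟩
  · rw [List.isChain_cons]
    refine ⟨?_, a2⟩
    intro y hy
    rw [List.head?_eq_getElem?] at hy
    grind
  · intro x hx y hy
    simp only [List.head?_cons, Option.mem_def, Option.some.injEq] at hy
    subst hy
    rw [List.getLast?_eq_getElem?] at hx
    have : x = l[l.length - 1] := by grind
    rw [this]; exact h2.symm

theorem IsCyc.cross {W : Type*} {H : SimpleGraph W} {l : List W}
    (h : IsCyc H l) (v : W) (hv : v ∉ l) (k : ℕ) (hk : k + 1 < l.length)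
    (h1 : H.Adj v (l[k])) (h2 : H.Adj v (l[l.length - 1])) (h3 : H.Adj (l[0]) (l[k+1])) :
    IsCyc H (v :: ((l.take (k+1)).reverse ++ l.drop (k+1))) := by
  obtain ⟨a1, a2, a3⟩ := h
  have hch : ((l.take (k+1)).reverse ++ l.drop (k+1)).IsChain H.Adj := by
    rw [List.isChain_append]
    refine ⟨?_, a2.drop _, ?_⟩
    · rw [List.isChain_reverse]
      exact (a2.take _).imp (fun a b h => h.symm)
    · intro x hx y hy
      rw [List.getLast?_reverse, List.head?_take, if_neg (by omega),
        List.head?_eq_getElem?] at hx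
      rw [List.head?_drop] at hy
      have e1 : x = l[0] := by grind
      have e2 : y = l[k+1] := by grind
      rw [e1, e2]; exact h3
  have hperm : ((l.take (k+1)).reverse ++ l.drop (k+1)).Perm l := by
    conv_rhs => rw [← List.take_append_drop (k+1) l]
    exact (List.reverse_perm _).append_right _
  have hlen := hperm.length_eq
  refine IsCyc.of_path (hperm.nodup_iff.2 a1) hch v (by rwa [hperm.mem_iff]) (by omega) ?_ ?_
  · rw [List.getElem_append_left (by simp; omega), List.getElem_reverse]
    simp only [List.length_take, List.getElem_take]
    convert h1 using 2
    omega
  · rw [List.getElem_append_right (by simp; omega), List.getElem_drop]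
    convert h2 using 2
    simp; omega

/-- A vertex with at least `2m` neighbours on a cycle either extends the cycle or yields
an independent set of size `2m+1`. -/
theorem IsCyc.extend {W : Type*} [DecidableEq W] {H : SimpleGraph W} [DecidableRel H.Adj]
    {l : List W} (h : IsCyc H l) (v : W) (hv : v ∉ l) (r : ℕ)
    (hind : ∀ J : Finset W, r < J.card → ∃ x ∈ J, ∃ y ∈ J, x ≠ y ∧ H.Adj x y)
    (hdeg : r ≤ (l.toFinset.filter (fun w => H.Adj v w)).card) :
    ∃ l', IsCyc H l' ∧ l'.Perm (v :: l) := by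
  classical
  by_cases h0 : l.length = 0
  · have : l = [] := List.length_eq_zero_iff.1 h0
    subst this
    exact ⟨[v], ⟨by simp, by simp, by
      obtain ⟨x, hx, y, hy, hxy, _⟩ := hind {v} (by simp at hdeg; simp [hdeg])
      simp_all⟩, by simp⟩
  have h0 : 0 < l.length := Nat.pos_of_ne_zero h0
  set n := l.length with hn
  let s : Fin n → W := fun i => l[(i.1 + 1) % n]'(Nat.mod_lt _ h0)
  have hsinj : Function.Injective s := by
    intro i j hij
    have := (h.1.getElem_inj_iff).1 hij
    have hi := i.2
    have hj := j.2
    have e := Nat.ModEq.add_right_cancel' 1 this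
    exact Fin.ext (Nat.ModEq.eq_of_lt_of_lt e hi hj)
  have hsmem : ∀ i, s i ∈ l := fun i => List.getElem_mem _
  let I : Finset (Fin n) := Finset.univ.filter (fun i => H.Adj v (l[i.1]))
  have hI : r ≤ I.card := by
    refine hdeg.trans ?_
    have : l.toFinset.filter (fun w => H.Adj v w) ⊆ I.image (fun i => l[i.1]) := by
      intro w hw
      simp only [Finset.mem_filter, List.mem_toFinset] at hw
      obtain ⟨k, hk, rfl⟩ := List.getElem_of_mem hw.1
      simp only [Finset.mem_image]
      exact ⟨⟨k, hk⟩, by simp [I, hw.2], rfl⟩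
    exact (Finset.card_le_card this).trans Finset.card_image_le
  have hrlen : ∀ k, (l.rotate k).length = n := by intro k; simp [hn]
  -- consecutive case
  have c1 : ∀ i ∈ I, H.Adj v (s i) → ∃ l', IsCyc H l' ∧ l'.Perm (v :: l) := by
    intro i hi hvi
    simp only [I, Finset.mem_filter, Finset.mem_univ, true_and] at hi
    have hr := h.rotate (i.1 + 1) (by omega)
    refine ⟨v :: l.rotate (i.1 + 1), IsCyc.of_path hr.1 hr.2.1 v (by simpa using hv)
      (by rw [hrlen]; exact h0) ?_ ?_, (List.rotate_perm _ _).cons _⟩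
    · rw [List.getElem_rotate]
      simpa [s] using hvi
    · rw [List.getElem_rotate]
      convert hi using 2
      rw [hrlen, ← hn, show n - 1 + (i.1 + 1) = i.1 + n by omega, Nat.add_mod_right,
        Nat.mod_eq_of_lt i.2]
  have c2 : ∀ i ∈ I, ∀ j ∈ I, i ≠ j → H.Adj (s i) (s j) →
      ∃ l', IsCyc H l' ∧ l'.Perm (v :: l) := by
    intro i hi j hj hij hadj
    simp only [I, Finset.mem_filter, Finset.mem_univ, true_and] at hi hj
    have hr := h.rotate (j.1 + 1) (by omega)
    have hij' : i.1 ≠ j.1 := fun h => hij (Fin.ext h)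
    obtain ⟨k, hk, hk1⟩ : ∃ k, k + 1 < n ∧ (k + (j.1 + 1) = i.1 ∨ k + (j.1 + 1) = i.1 + n) := by
      rcases lt_or_gt_of_ne hij' with hlt | hlt
      · exact ⟨i.1 + n - (j.1 + 1), by omega, by omega⟩
      · exact ⟨i.1 - (j.1 + 1), by omega, by omega⟩
    have hkm : (k + (j.1 + 1)) % n = i.1 := by
      rcases hk1 with e | e <;> rw [e]
      · exact Nat.mod_eq_of_lt i.2
      · rw [Nat.add_mod_right, Nat.mod_eq_of_lt i.2]
    refine ⟨_, hr.cross v (by simpa using hv) k (by rw [hrlen]; exact hk) ?_ ?_ ?_, ?_⟩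
    · rw [List.getElem_rotate]
      convert hi using 2
    · rw [List.getElem_rotate]
      convert hj using 2
      rw [hrlen, ← hn, show n - 1 + (j.1 + 1) = j.1 + n by omega, Nat.add_mod_right,
        Nat.mod_eq_of_lt j.2]
    · rw [List.getElem_rotate, List.getElem_rotate]
      convert hadj.symm using 2
      · simp [hn]
      · rcases hk1 with e | e
        · rw [← hn, ← e]; congr 1; omega
        · rw [← hn, show k + 1 + (j.1 + 1) = i.1 + 1 + n by omega, Nat.add_mod_right]
    · apply List.Perm.cons
      refine List.Perm.trans ?_ (List.rotate_perm l (j.1 + 1))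
      conv_rhs => rw [← List.take_append_drop (k+1) (l.rotate (j.1+1))]
      exact (List.reverse_perm _).append_right _
  have hvI : v ∉ I.image s := by
    simp only [Finset.mem_image, not_exists, not_and]
    rintro i _ rfl
    exact hv (hsmem i)
  obtain ⟨x, hx, y, hy, hxy, hadj⟩ := hind (insert v (I.image s)) (by
    rw [Finset.card_insert_of_notMem hvI, Finset.card_image_of_injective _ hsinj]; omega)
  simp only [Finset.mem_insert, Finset.mem_image] at hx hy
  rcases hx with rfl | ⟨i, hi, rfl⟩ <;> rcases hy with rfl | ⟨j, hj, rfl⟩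
  · exact absurd rfl hxy
  · exact c1 j hj hadj
  · exact c1 i hi hadj.symm
  · exact c2 i hi j hj (fun e => hxy (by rw [e])) hadj

theorem matching_or_indep {W : Type*} [DecidableEq W] (G : SimpleGraph W) (k : ℕ) :
    ∀ A : Finset W,
    (∃ f : Fin k × Bool → W, Function.Injective f ∧ (∀ x, f x ∈ A) ∧
      ∀ i, G.Adj (f (i, true)) (f (i, false))) ∨
    ∃ B ⊆ A, (∀ x ∈ B, ∀ y ∈ B, ¬ G.Adj x y) ∧ A.card + 2 ≤ B.card + 2 * k := by
  induction k with
  | zero =>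
    intro A
    exact Or.inl ⟨fun x => x.1.elim0, fun x => x.1.elim0, fun x => x.1.elim0, fun i => i.elim0⟩
  | succ k ih =>
    intro A
    by_cases hA : ∀ x ∈ A, ∀ y ∈ A, ¬ G.Adj x y
    · exact Or.inr ⟨A, subset_rfl, hA, by omega⟩
    push Not at hA
    obtain ⟨a, ha, b, hb, hab⟩ := hA
    have hne : a ≠ b := hab.ne
    have hcard : ((A.erase a).erase b).card + 2 = A.card := by
      have h1 := Finset.card_erase_add_one ha
      have h2 := Finset.card_erase_add_one (show b ∈ A.erase a from
        Finset.mem_erase.2 ⟨hne.symm, hb⟩)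
      omega
    rcases ih ((A.erase a).erase b) with ⟨f, hf, hfA, hfe⟩ | ⟨B, hB, hBi, hBc⟩
    · left
      have hfa : ∀ x, f x ≠ a := fun x hx => by have := hfA x; simp [hx] at this
      have hfb : ∀ x, f x ≠ b := fun x hx => by have := hfA x; simp [hx] at this
      have hfA' : ∀ x, f x ∈ A := fun x => by have := hfA x; simp at this; exact this.2.2
      refine ⟨fun p => Fin.cases (if p.2 then a else b) (fun i => f (i, p.2)) p.1, ?_, ?_, ?_⟩
      · rintro ⟨i, s⟩ ⟨j, t⟩ h
        induction i using Fin.cases with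
        | zero =>
          induction j using Fin.cases with
          | zero =>
            cases s <;> cases t <;> simp_all
          | succ j =>
            simp only [Fin.cases_zero, Fin.cases_succ] at h
            cases s
            · exact absurd h.symm (hfb _)
            · exact absurd h.symm (hfa _)
        | succ i =>
          induction j using Fin.cases with
          | zero =>
            simp only [Fin.cases_zero, Fin.cases_succ] at h
            cases t
            · exact absurd h (hfb _)
            · exact absurd h (hfa _)
          | succ j =>
            simp only [Fin.cases_succ] at h
            have := hf h
            simp_all
      · rintro ⟨i, s⟩
        induction i using Fin.cases with
        | zero => cases s <;> simp [ha, hb]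
        | succ i => simpa using hfA' _
      · intro i
        induction i using Fin.cases with
        | zero => simpa using hab
        | succ i => simpa using hfe i
    · right
      exact ⟨B, hB.trans ((Finset.erase_subset _ _).trans (Finset.erase_subset _ _)), hBi, by omega⟩

theorem indep_of_no_fan {W : Type*} [DecidableEq W] (G : SimpleGraph W) (m : ℕ)
    (hnoF : ¬ Contains G (fan m)) (v : W) (A : Finset W) (hA : ∀ x ∈ A, G.Adj v x) :
    ∃ B ⊆ A, (∀ x ∈ B, ∀ y ∈ B, ¬ G.Adj x y) ∧ A.card + 2 ≤ B.card + 2 * m := by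
  rcases matching_or_indep G m A with ⟨f, hf, hfA, hfe⟩ | h
  · exfalso
    apply hnoF
    have hv : ∀ x, G.Adj v (f x) := fun x => hA _ (hfA x)
    refine ⟨fun p => Sum.elim (fun _ => v) f p, ?_, ?_⟩
    · rintro (x | x) (y | y) h
      · rfl
      · exact absurd h (hv y).ne
      · exact absurd h (hv x).ne'
      · exact congrArg _ (hf h)
    · rintro (x | x) (y | y) h
      · exact absurd rfl h.ne
      · exact hv y
      · exact (hv x).symm
      · simp only [fan, SimpleGraph.fromRel_adj] at h
        rcases h.2 with (⟨u, hu⟩ | ⟨i, h1, h2⟩) | (⟨u, hu⟩ | ⟨i, h1, h2⟩)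
        · cases hu
        · cases h1; cases h2; exact hfe i
        · cases hu
        · cases h1; cases h2; exact (hfe i).symm
  · exact h

theorem no_clique_of_no_fan {W : Type*} [DecidableEq W] (G : SimpleGraph W) (m : ℕ)
    (hnoF : ¬ Contains G (fan m)) (J : Finset W) (hJ : 2 * m < J.card) :
    ∃ x ∈ J, ∃ y ∈ J, x ≠ y ∧ Gᶜ.Adj x y := by
  by_contra hcon
  have hcl : ∀ x ∈ J, ∀ y ∈ J, x ≠ y → G.Adj x y := by
    intro x hx y hy hxy
    by_contra hn
    exact hcon ⟨x, hx, y, hy, hxy, by rw [SimpleGraph.compl_adj]; exact ⟨hxy, hn⟩⟩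
  obtain ⟨v, hv⟩ : J.Nonempty := Finset.card_pos.1 (by omega)
  obtain ⟨B, hB, hBi, hBc⟩ := indep_of_no_fan G m hnoF v (J.erase v) (by
    intro x hx
    rw [Finset.mem_erase] at hx
    exact hcl v hv x hx.2 hx.1.symm)
  have := Finset.card_erase_add_one hv
  obtain ⟨x, hx, y, hy, hxy⟩ := Finset.one_lt_card.1 (show 1 < B.card by omega)
  exact hBi x hx y hy (hcl x (Finset.mem_of_mem_erase (hB hx)) y
    (Finset.mem_of_mem_erase (hB hy)) hxy)

theorem exists_outside {W : Type*} [DecidableEq W] (S T : Finset W) (h : T.card < S.card) :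
    ∃ x ∈ S, x ∉ T := by
  by_contra hcon
  push Not at hcon
  exact absurd (Finset.card_le_card hcon) (by omega)

/-- Dense sets in the complement contain cycles of all lengths. -/
theorem dense_cycles {W : Type*} [DecidableEq W] (G : SimpleGraph W) [DecidableRel G.Adj]
    (r d : ℕ) (hr : 3 ≤ r)
    (hind : ∀ J : Finset W, r < J.card → ∃ x ∈ J, ∃ y ∈ J, x ≠ y ∧ Gᶜ.Adj x y)
    (S : Finset W) (hd : ∀ v ∈ S, (S.filter (fun w => G.Adj v w)).card ≤ d)
    (hS : 3 * d + r ≤ S.card) (k : ℕ) (hk3 : 3 ≤ k) :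
    k ≤ S.card → ∃ l : List W, IsCyc Gᶜ l ∧ l.length = k ∧ ∀ x ∈ l, x ∈ S := by
  have hcompl : ∀ v ∈ S, ∀ w ∈ S, v ≠ w → w ∉ S.filter (fun w => G.Adj v w) → Gᶜ.Adj w v := by
    intro v hv w hw hvw hn
    rw [SimpleGraph.compl_adj]
    refine ⟨hvw.symm, fun h => hn ?_⟩
    simp [hw, h.symm]
  induction k, hk3 using Nat.le_induction with
  | base =>
    intro _
    obtain ⟨u, hu⟩ : S.Nonempty := Finset.card_pos.1 (by omega)
    obtain ⟨w, hw, hw'⟩ := exists_outside S (insert u (S.filter (fun w => G.Adj u w))) (by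
      have := Finset.card_insert_le u (S.filter (fun w => G.Adj u w))
      have := hd u hu
      omega)
    obtain ⟨x, hx, hx'⟩ := exists_outside S (insert u (insert w
        (S.filter (fun z => G.Adj u z) ∪ S.filter (fun z => G.Adj w z)))) (by
      have h1 := Finset.card_insert_le u (insert w
        (S.filter (fun z => G.Adj u z) ∪ S.filter (fun z => G.Adj w z)))
      have h2 := Finset.card_insert_le w
        (S.filter (fun z => G.Adj u z) ∪ S.filter (fun z => G.Adj w z))
      have h3 := Finset.card_union_le (S.filter (fun z => G.Adj u z)) (S.filter (fun z => G.Adj w z))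
      have := hd u hu
      have := hd w hw
      omega)
    rw [Finset.mem_insert, not_or] at hw'
    rw [Finset.mem_insert, Finset.mem_insert, Finset.mem_union, not_or, not_or, not_or] at hx'
    have e1 := hcompl u hu w hw (Ne.symm hw'.1) hw'.2
    have e2 := hcompl u hu x hx (Ne.symm hx'.1) hx'.2.2.1
    have e3 := hcompl w hw x hx (Ne.symm hx'.2.1) hx'.2.2.2
    refine ⟨[x, w, u], IsCyc.of_path ?_ ?_ x ?_ (by simp) ?_ ?_, by simp, ?_⟩
    · simp [hw'.1]
    · simpa using e1
    · simp [hx'.1, hx'.2.1]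
    · simpa using e3
    · simpa using e2
    · simp [hu, hw, hx]
  | succ k hk ih =>
    intro hkS
    obtain ⟨l, hl, hlen, hlS⟩ := ih (by omega)
    have hcl : l.toFinset.card = k := by rw [List.toFinset_card_of_nodup hl.1, hlen]
    by_cases hc : k + 2 * d < S.card
    · have m0 : l[0] ∈ S := hlS _ (List.getElem_mem _)
      have m1 : l[l.length - 1] ∈ S := hlS _ (List.getElem_mem _)
      obtain ⟨x, hx, hx'⟩ := exists_outside S (l.toFinset ∪
        (S.filter (fun z => G.Adj l[0] z) ∪ S.filter (fun z => G.Adj l[l.length - 1] z))) (by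
        have h2 := Finset.card_union_le l.toFinset
          (S.filter (fun z => G.Adj l[0] z) ∪ S.filter (fun z => G.Adj l[l.length - 1] z))
        have h3 := Finset.card_union_le (S.filter (fun z => G.Adj l[0] z))
          (S.filter (fun z => G.Adj l[l.length - 1] z))
        have := hd _ m0
        have := hd _ m1
        omega)
      rw [Finset.mem_union, Finset.mem_union, not_or, not_or, List.mem_toFinset] at hx'
      refine ⟨x :: l, IsCyc.of_path hl.1 hl.2.1 x hx'.1 (by omega) ?_ ?_, by simp [hlen], ?_⟩
      · exact hcompl _ m0 x hx (fun e => hx'.1 (e ▸ List.getElem_mem _)) hx'.2.1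
      · exact hcompl _ m1 x hx (fun e => hx'.1 (e ▸ List.getElem_mem _)) hx'.2.2
      · intro y hy
        rcases List.mem_cons.1 hy with rfl | hy
        · exact hx
        · exact hlS y hy
    · obtain ⟨x, hx, hx'⟩ := exists_outside S l.toFinset (by omega)
      rw [List.mem_toFinset] at hx'
      obtain ⟨l', hl', hp⟩ := hl.extend x hx' r hind (by
        have h1 : l.toFinset ⊆ l.toFinset.filter (fun w => Gᶜ.Adj x w) ∪
            S.filter (fun w => G.Adj x w) := by
          intro y hy
          rw [Finset.mem_union]
          by_cases hxy : G.Adj x y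
          · right; simp [hxy, hlS y (List.mem_toFinset.1 hy)]
          · left
            rw [Finset.mem_filter, SimpleGraph.compl_adj]
            exact ⟨hy, fun e => hx' (e ▸ List.mem_toFinset.1 hy), hxy⟩
        have h2 := Finset.card_le_card h1
        have h3 := Finset.card_union_le (l.toFinset.filter (fun w => Gᶜ.Adj x w))
            (S.filter (fun w => G.Adj x w))
        have := hd x hx
        omega)
      refine ⟨l', hl', by rw [hp.length_eq]; simp [hlen], ?_⟩
      intro y hy
      rcases List.mem_cons.1 (hp.mem_iff.1 hy) with rfl | hy
      · exact hx
      · exact hlS y hy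

/-- All cycles of length up to `n` in the complement. -/
theorem all_cycles {W : Type*} [Fintype W] [DecidableEq W] (G : SimpleGraph W)
    [DecidableRel G.Adj] (m n : ℕ) (hm : 18 ≤ m) (hn : 17 * m + 1 ≤ n)
    (hGcard : Fintype.card W = 2 * n - 1) (hnoF : ¬ Contains G (fan m))
    (hD : G.maxDegree + 1 ≤ n) (k : ℕ) (hk3 : 3 ≤ k) :
    k ≤ n → ∃ l : List W, IsCyc Gᶜ l ∧ l.length = k := by
  have hind := no_clique_of_no_fan G m hnoF
  have hdeg : ∀ v, (Finset.univ.filter (fun w => G.Adj v w)).card ≤ G.maxDegree := by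
    intro v
    have := G.degree_le_maxDegree v
    rwa [← SimpleGraph.card_neighborFinset_eq_degree, SimpleGraph.neighborFinset_eq_filter] at this
  set D := G.maxDegree with hDdef
  by_cases hsmall : 3 * D + 2 * m ≤ 2 * n - 1
  · intro hk
    obtain ⟨l, hl, hlen, _⟩ := dense_cycles G (2 * m) D (by omega) hind Finset.univ
      (fun v _ => hdeg v) (by rw [Finset.card_univ, hGcard]; exact hsmall) k hk3
      (by rw [Finset.card_univ, hGcard]; omega)
    exact ⟨l, hl, hlen⟩
  have : Nonempty W := Fintype.card_pos_iff.1 (by omega)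
  obtain ⟨v, hv⟩ := G.exists_maximal_degree_vertex
  obtain ⟨B, -, hBi, hBc⟩ := indep_of_no_fan G m hnoF v (G.neighborFinset v) (by simp)
  rw [SimpleGraph.card_neighborFinset_eq_degree, ← hv, ← hDdef] at hBc
  have hclq : ∀ k, 3 ≤ k → k ≤ B.card → ∃ l : List W, IsCyc Gᶜ l ∧ l.length = k := by
    intro k hk3 hk
    obtain ⟨l, hl, hlen, _⟩ := dense_cycles G (2 * m) 0 (by omega) hind B
      (fun v hv => by
        rw [Nat.le_zero, Finset.card_eq_zero, Finset.filter_eq_empty_iff]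
        exact fun w hw => hBi v hv w hw) (by omega) k hk3 hk
    exact ⟨l, hl, hlen⟩
  induction k, hk3 using Nat.le_induction with
  | base => intro _; exact hclq 3 le_rfl (by omega)
  | succ k hk ih =>
    intro hkn
    by_cases hkB : k + 1 ≤ B.card
    · exact hclq _ (by omega) hkB
    obtain ⟨l, hl, hlen⟩ := ih (by omega)
    have hcl : l.toFinset.card = k := by rw [List.toFinset_card_of_nodup hl.1, hlen]
    by_contra hcon
    have hout : ∀ x, x ∉ l → (l.toFinset.filter (fun w => Gᶜ.Adj x w)).card < 2 * m := by
      intro x hx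
      by_contra hc
      obtain ⟨l', hl', hp⟩ := hl.extend x hx (2 * m) hind (by omega)
      exact hcon ⟨l', hl', by rw [hp.length_eq]; simp [hlen]⟩
    have hRc : (l.toFinsetᶜ).card = 2 * n - 1 - k := by
      rw [Finset.card_compl, hGcard, hcl]
    obtain ⟨l', hl', hlen', _⟩ := dense_cycles G (2 * m) (D + 2 * m - 1 - k) (by omega) hind
      l.toFinsetᶜ (by
        intro x hx
        rw [Finset.mem_compl, List.mem_toFinset] at hx
        have h0 := hout x hx
        have h1 : l.toFinset ⊆ l.toFinset.filter (fun w => Gᶜ.Adj x w) ∪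
            l.toFinset.filter (fun w => G.Adj x w) := by
          intro y hy
          rw [Finset.mem_union]
          by_cases hxy : G.Adj x y
          · right; rw [Finset.mem_filter]; exact ⟨hy, hxy⟩
          · left
            rw [Finset.mem_filter, SimpleGraph.compl_adj]
            exact ⟨hy, fun e => hx (e ▸ List.mem_toFinset.1 hy), hxy⟩
        have h2 := Finset.card_le_card h1
        have h3 := Finset.card_union_le (l.toFinset.filter (fun w => Gᶜ.Adj x w))
            (l.toFinset.filter (fun w => G.Adj x w))
        have h4 := hdeg x
        have h5 : (l.toFinset.filter (fun w => G.Adj x w)).card +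
            (l.toFinsetᶜ.filter (fun w => G.Adj x w)).card ≤
            (Finset.univ.filter (fun w => G.Adj x w)).card := by
          rw [← Finset.card_union_of_disjoint]
          · apply Finset.card_le_card
            intro y hy
            simp at hy ⊢
            tauto
          · exact Finset.disjoint_filter_filter disjoint_compl_right
        omega) (by omega) (k + 1) (by omega) (by omega)
    exact hcon ⟨l', hl', hlen'⟩

/-- A partial embedding of the tree `T` into `H`, defined on the set `S` of vertices, which is
connected within itself and contains the root `x`. -/
def GoodEmb {V W : Type*} (T : SimpleGraph V) (H : SimpleGraph W) (x : V) (S : Finset V)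
    (f : V → W) : Prop :=
  (∀ u ∈ S, ∃ p : T.Walk x u, ∀ z ∈ p.support, z ∈ S) ∧ Set.InjOn f S ∧
    ∀ u ∈ S, ∀ v ∈ S, T.Adj u v → H.Adj (f u) (f v)

theorem GoodEmb.insert {V W : Type*} [DecidableEq V] {T : SimpleGraph V} {H : SimpleGraph W}
    {x : V} {S : Finset V} {f : V → W} (hT : T.IsAcyclic) (h : GoodEmb T H x S f)
    {u v : V} (hu : u ∈ S) (hv : v ∉ S) (huv : T.Adj u v) {w : W} (hw : ∀ z ∈ S, f z ≠ w)
    (hadj : H.Adj (f u) w) : GoodEmb T H x (insert v S) (Function.update f v w) := by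
  obtain ⟨h1, h2, h3⟩ := h
  have hf : ∀ z ∈ S, Function.update f v w z = f z := by
    intro z hz
    rw [Function.update_of_ne]
    rintro rfl
    exact hv hz
  have huniq : ∀ u' ∈ S, T.Adj u' v → u' = u := by
    intro u' hu' hadj'
    by_contra hne
    obtain ⟨p, hp⟩ := h1 u hu
    obtain ⟨q, hq⟩ := h1 u' hu'
    let r := (q.reverse.append p).toPath
    have hr : ∀ z ∈ (r : T.Walk u' u).support, z ∈ S := by
      intro z hz
      have := SimpleGraph.Walk.support_toPath_subset _ hz
      rw [SimpleGraph.Walk.mem_support_append_iff, SimpleGraph.Walk.support_reverse,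
        List.mem_reverse] at this
      rcases this with h | h
      · exact hq z h
      · exact hp z h
    let s : T.Path u' u := ⟨.cons hadj' (.cons huv.symm .nil), by
      simp [SimpleGraph.Walk.cons_isPath_iff, huv.ne', hadj'.ne, hne]⟩
    have hrs : r = s := hT.path_unique r s
    exact hv (hr v (by rw [hrs]; simp [s]))
  refine ⟨?_, ?_, ?_⟩
  · intro z hz
    rcases Finset.mem_insert.1 hz with rfl | hz
    · obtain ⟨p, hp⟩ := h1 u hu
      refine ⟨p.concat huv, ?_⟩
      intro y hy
      rw [SimpleGraph.Walk.support_concat] at hy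
      rw [Finset.mem_insert]
      simp at hy
      rcases hy with hy | hy
      · exact Or.inr (hp y hy)
      · exact Or.inl hy
    · obtain ⟨p, hp⟩ := h1 z hz
      exact ⟨p, fun y hy => Finset.mem_insert_of_mem (hp y hy)⟩
  · intro a ha b hb hab
    rw [Finset.mem_coe, Finset.mem_insert] at ha hb
    rcases ha with rfl | ha <;> rcases hb with rfl | hb
    · rfl
    · rw [hf b hb, Function.update_self] at hab
      exact absurd hab.symm (hw b hb)
    · rw [hf a ha, Function.update_self] at hab
      exact absurd hab (hw a ha)
    · rw [hf a ha, hf b hb] at hab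
      exact h2 ha hb hab
  · intro a ha b hb hab
    rw [Finset.mem_insert] at ha hb
    rcases ha with rfl | ha <;> rcases hb with rfl | hb
    · exact absurd rfl hab.ne
    · rw [hf b hb, Function.update_self, huniq b hb hab.symm]
      exact hadj.symm
    · rw [hf a ha, Function.update_self, huniq a ha hab]
      exact hadj
    · rw [hf a ha, hf b hb]
      exact h3 a ha b hb hab

theorem emb_path {V W : Type*} [DecidableEq V] {T : SimpleGraph V} {H : SimpleGraph W}
    (hT : T.IsAcyclic) {x y : V} (p : T.Walk x y) (hp : p.IsPath) (l : List W)
    (hnd : l.Nodup) (hch : l.IsChain H.Adj) (hlen : l.length = p.length + 1) (k : ℕ) :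
    k ≤ p.length → ∃ f : V → W, GoodEmb T H x ((Finset.range (k+1)).image p.getVert) f ∧
      ∀ i ≤ k, some (f (p.getVert i)) = l[i]? := by
  have hinj : ∀ i ≤ p.length, ∀ j ≤ p.length, p.getVert i = p.getVert j → i = j :=
    fun i hi j hj h => hp.getVert_injOn hi hj h
  induction k with
  | zero =>
    intro _
    refine ⟨fun _ => l[0], ⟨?_, ?_, ?_⟩, ?_⟩
    · intro u hu
      have : u = x := by simpa using hu
      subst this
      exact ⟨.nil, by simp⟩
    · intro a ha b hb _
      simp at ha hb
      rw [ha, hb]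
    · intro a ha b hb hab
      simp at ha hb
      rw [ha, hb] at hab
      exact absurd rfl hab.ne
    · intro i hi
      have : i = 0 := by omega
      subst this
      simp
  | succ k ih =>
    intro hk
    obtain ⟨f, hf, hfi⟩ := ih (by omega)
    have hnew : p.getVert (k+1) ∉ (Finset.range (k+1)).image p.getVert := by
      rw [Finset.mem_image]
      rintro ⟨i, hi, he⟩
      rw [Finset.mem_range] at hi
      have := hinj i (by omega) (k+1) hk he
      omega
    have hfe : ∀ i (hi : i ≤ k), f (p.getVert i) = l[i] := by
      intro i hi
      have := hfi i hi
      rw [List.getElem?_eq_getElem (by omega)] at this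
      exact Option.some.inj this
    refine ⟨Function.update f (p.getVert (k+1)) l[k+1], ?_, ?_⟩
    · rw [Finset.range_add_one, Finset.image_insert]
      refine hf.insert hT (u := p.getVert k) ?_ hnew (p.adj_getVert_succ (by omega)) ?_ ?_
      · exact Finset.mem_image_of_mem _ (by simp)
      · intro z hz
        obtain ⟨i, hi, rfl⟩ := Finset.mem_image.1 hz
        rw [Finset.mem_range] at hi
        rw [hfe i (by omega)]
        intro he
        have := (hnd.getElem_inj_iff).1 he
        omega
      · rw [hfe k le_rfl]
        exact List.isChain_iff_getElem.1 hch k (by omega)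
    · intro i hi
      by_cases hik : i = k + 1
      · subst hik
        rw [Function.update_self, List.getElem?_eq_getElem]
      · rw [Function.update_of_ne, hfi i (by omega)]
        intro he
        exact hik (hinj i (by omega) (k+1) hk he)

theorem emb_greedy {V W : Type*} [Fintype V] [DecidableEq V] [Fintype W] [DecidableEq W]
    {T : SimpleGraph V} {H : SimpleGraph W} [DecidableRel H.Adj]
    (hT : T.IsTree) (hdeg : ∀ w, Fintype.card V ≤ H.degree w + 1) (x : V) (c : ℕ) :
    ∀ (S : Finset V) (f : V → W), x ∈ S → GoodEmb T H x S f → Fintype.card V ≤ S.card + c →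
    ∃ g : V → W, GoodEmb T H x Finset.univ g ∧ ∀ z ∈ S, g z = f z := by
  induction c with
  | zero =>
    intro S f hx hf hS
    have : S = Finset.univ := (Finset.card_eq_iff_eq_univ S).1
      (le_antisymm (Finset.card_le_univ S) (by omega))
    subst this
    exact ⟨f, hf, fun _ _ => rfl⟩
  | succ c ih =>
    intro S f hx hf hS
    by_cases huniv : S = Finset.univ
    · subst huniv
      exact ⟨f, hf, fun _ _ => rfl⟩
    obtain ⟨y, hy⟩ : ∃ y, y ∉ S := by
      by_contra hcon
      push Not at hcon
      exact huniv (Finset.eq_univ_iff_forall.2 hcon)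
    obtain ⟨p⟩ := hT.1 x y
    obtain ⟨d, -, hd1, hd2⟩ := p.exists_boundary_dart (S : Set V) hx hy
    have hlt : S.card < Fintype.card V := (Finset.card_lt_iff_ne_univ S).2 huniv
    obtain ⟨w, hw, hw'⟩ := exists_outside (H.neighborFinset (f d.fst))
      ((S.erase d.fst).image f) (by
        have h1 := Finset.card_image_le (s := S.erase d.fst) (f := f)
        have h2 := Finset.card_erase_add_one (show d.fst ∈ S from hd1)
        have h3 := hdeg (f d.fst)
        rw [SimpleGraph.card_neighborFinset_eq_degree]
        omega)
    rw [SimpleGraph.mem_neighborFinset] at hw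
    have hgood := hf.insert hT.2 (u := d.fst) (v := d.snd) hd1 hd2 d.adj (w := w) (by
      intro z hz he
      by_cases hzd : z = d.fst
      · subst hzd; rw [he] at hw; exact absurd rfl hw.ne
      · exact hw' (Finset.mem_image.2 ⟨z, Finset.mem_erase.2 ⟨hzd, hz⟩, he⟩)) hw
    obtain ⟨g, hg, hgf⟩ := ih _ _ (Finset.mem_insert_of_mem hx) hgood (by
      rw [Finset.card_insert_of_notMem hd2]; omega)
    refine ⟨g, hg, fun z hz => ?_⟩
    rw [hgf z (Finset.mem_insert_of_mem hz), Function.update_of_ne]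
    rintro rfl
    exact hd2 hz

theorem unicyclic_contained {V W : Type*} [Fintype V] [Fintype W]
    (U : SimpleGraph V) (hUconn : U.Connected)
    (hUedges : U.edgeSet.ncard = Fintype.card V)
    (H : SimpleGraph W) [DecidableRel H.Adj] (hdeg : ∀ w, Fintype.card V ≤ H.degree w + 1)
    (hcyc : ∀ k, 3 ≤ k → k ≤ Fintype.card V → ∃ l : List W, IsCyc H l ∧ l.length = k) :
    Contains H U := by
  classical
  have hnac : ¬ U.IsAcyclic := by
    intro hac
    have := (SimpleGraph.isTree_iff_connected_and_card.1 ⟨hUconn, hac⟩).2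
    rw [Nat.card_coe_set_eq, hUedges, Nat.card_eq_fintype_card] at this
    omega
  rw [SimpleGraph.isAcyclic_iff_forall_adj_isBridge] at hnac
  push Not at hnac
  obtain ⟨x, y, hxy, hnb⟩ := hnac
  have hTconn := hUconn.connected_delete_edge_of_not_isBridge hnb
  set T := U.deleteEdges {s(x, y)} with hTdef
  have hT : T.IsTree := by
    rw [SimpleGraph.isTree_iff_connected_and_card]
    refine ⟨hTconn, ?_⟩
    rw [Nat.card_coe_set_eq, hTdef, SimpleGraph.edgeSet_deleteEdges,
      Set.ncard_diff_singleton_add_one (show s(x, y) ∈ U.edgeSet from hxy) (Set.toFinite _),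
      hUedges, Nat.card_eq_fintype_card]
  obtain ⟨p, hp⟩ := (hTconn x y).exists_isPath
  have hpl : 2 ≤ p.length := by
    by_contra hlt
    have hcases : p.length = 0 ∨ p.length = 1 := by omega
    rcases hcases with h | h
    · exact hxy.ne (SimpleGraph.Walk.eq_of_length_eq_zero h)
    · have := SimpleGraph.Walk.adj_of_length_eq_one h
      simp [hTdef] at this
  obtain ⟨l, hl, hlen⟩ := hcyc (p.length + 1) (by omega) hp.length_lt
  obtain ⟨f, hf, hfi⟩ := emb_path hT.2 p hp l hl.1 hl.2.1 hlen p.length le_rfl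
  have hxS : x ∈ (Finset.range (p.length+1)).image p.getVert :=
    Finset.mem_image.2 ⟨0, by simp, by simp⟩
  have hyS : y ∈ (Finset.range (p.length+1)).image p.getVert :=
    Finset.mem_image.2 ⟨p.length, by simp, by simp⟩
  obtain ⟨g, ⟨-, hg1, hg2⟩, hgf⟩ := emb_greedy hT hdeg x (Fintype.card V) _ f hxS hf (by omega)
  have hgxy : H.Adj (g y) (g x) := by
    rw [hgf y hyS, hgf x hxS]
    apply hl.2.2
    · have := hfi p.length le_rfl
      rw [SimpleGraph.Walk.getVert_length] at this
      rw [List.getLast?_eq_getElem?, hlen]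
      exact this.symm
    · have := hfi 0 (by omega)
      rw [SimpleGraph.Walk.getVert_zero] at this
      rw [List.head?_eq_getElem?]
      exact this.symm
  refine ⟨g, fun a b hab => hg1 (by simp) (by simp) hab, ?_⟩
  intro u v huv
  by_cases he : s(u, v) = s(x, y)
  · rw [Sym2.eq_iff] at he
    rcases he with ⟨rfl, rfl⟩ | ⟨rfl, rfl⟩
    · exact hgxy.symm
    · exact hgxy
  · exact hg2 u (by simp) v (by simp) (by rw [hTdef, SimpleGraph.deleteEdges_adj]; exact ⟨huv, he⟩)

end FanHelpers


/-- **Claim 4.1**: if `m ≥ 18`, `n ≥ m² - m + 1`, `U` is a unicyclic graph on `n` vertices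
(connected with exactly `n` edges) and `G` is a graph on `2n - 1` vertices containing no
`F_m` whose complement contains no `U`, then `Δ(G) ≥ n`. -/
theorem maxDegree_ge_of_no_fan_no_unicyclic {V W : Type*} [Fintype V] [Fintype W]
    (m n : ℕ) (hm : 18 ≤ m) (hn : m ^ 2 - m + 1 ≤ n)
    (U : SimpleGraph V) (hUconn : U.Connected) (hUcard : Fintype.card V = n)
    (hUedges : U.edgeSet.ncard = n)
    (G : SimpleGraph W) [DecidableRel G.Adj] (hGcard : Fintype.card W = 2 * n - 1)
    (hnoF : ¬ Contains G (fan m)) (hnoU : ¬ Contains Gᶜ U) :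
    n ≤ G.maxDegree := by
  classical
  by_contra hlt
  push Not at hlt
  have hn' : 17 * m + 1 ≤ n := by
    have h1 : m ^ 2 = m * m := sq m
    have h2 : 18 * m ≤ m * m := Nat.mul_le_mul_right m hm
    omega
  subst hUcard
  apply hnoU
  apply unicyclic_contained U hUconn hUedges
  · intro w
    have h1 := G.degree_compl w
    have h2 := G.degree_le_maxDegree w
    omega
  · intro k hk3 hk
    exact all_cycles G m _ hm hn' hGcard hnoF hlt k hk3 hk
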